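/- Informed-guess value for all three outcomes when Bob performs the separable measurement σz⊗σz: with ρ = |Ψ⁻⟩⟨Ψ⁻| ⊗ |Ψ⁻⟩⟨Ψ⁻| (16×16 matrix, ordering A,B₁,B₂,C) and Q⁰_± = ½(I₄ ± σz⊗σz) the eigenprojectors of σz⊗σz, one has max over a,c∈{0,1} and s∈{+,−} of Tr[ρ·(Π⁰_a ⊗ Q⁰_s ⊗ Π⁰_c)] = 3/16. (This corresponds to at most log₂(16/3) ≈ 2.41 certifiable bits for the triple of outcomes.) -/

import Mathlib

open Matrix Kronecker

noncomputable section

abbrev M2 := Matrix (Fin 2) (Fin 2) ℂ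
abbrev M4 := Matrix (Fin 2 × Fin 2) (Fin 2 × Fin 2) ℂ
abbrev Quad := Fin 2 × Fin 2 × Fin 2 × Fin 2
abbrev M16 := Matrix Quad Quad ℂ

/-- Pauli Z matrix. -/
def σz : M2 := !![1, 0; 0, -1]
/-- Pauli X matrix. -/
def σx : M2 := !![0, 1; 1, 0]

/-- The complex number 1/√2. -/
def invSqrt2 : ℂ := ((Real.sqrt 2 : ℝ) : ℂ)⁻¹

/-- Bell state Φ⁺ = (|00⟩+|11⟩)/√2. -/
def PhiP : Fin 2 × Fin 2 → ℂ := fun p =>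
  if p = (0, 0) then invSqrt2 else if p = (1, 1) then invSqrt2 else 0
/-- Bell state Φ⁻ = (|00⟩−|11⟩)/√2. -/
def PhiM : Fin 2 × Fin 2 → ℂ := fun p =>
  if p = (0, 0) then invSqrt2 else if p = (1, 1) then -invSqrt2 else 0
/-- Bell state Ψ⁺ = (|01⟩+|10⟩)/√2. -/
def PsiP : Fin 2 × Fin 2 → ℂ := fun p =>
  if p = (0, 1) then invSqrt2 else if p = (1, 0) then invSqrt2 else 0
/-- Bell state Ψ⁻ = (|01⟩−|10⟩)/√2. -/
def PsiM : Fin 2 × Fin 2 → ℂ := fun p =>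
  if p = (0, 1) then invSqrt2 else if p = (1, 0) then -invSqrt2 else 0

/-- Rank-one projector |ψ⟩⟨ψ|. -/
def proj {n : Type*} (ψ : n → ℂ) : Matrix n n ℂ := vecMulVec ψ (star ψ)

/-- The four Bell states, ordered Φ⁺, Φ⁻, Ψ⁺, Ψ⁻. -/
def Bell : Fin 4 → (Fin 2 × Fin 2 → ℂ) := ![PhiP, PhiM, PsiP, PsiM]

/-- Projectors onto the Bell states. -/
def P (b : Fin 4) : M4 := proj (Bell b)

/-- Kronecker product M_A ⊗ M_{B₁B₂} ⊗ M_C, in the tensor ordering A, B₁, B₂, C. -/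
def kron3 (MA : M2) (MB : M4) (MC : M2) : M16 := fun p q =>
  MA p.1 q.1 * MB (p.2.1, p.2.2.1) (q.2.1, q.2.2.1) * MC p.2.2.2 q.2.2.2

/-- The two-singlet state vector |Ψ⁻⟩_{AB₁} ⊗ |Ψ⁻⟩_{B₂C}. -/
def twoSinglets : Quad → ℂ := fun p => PsiM (p.1, p.2.1) * PsiM (p.2.2.1, p.2.2.2)

/-- The density matrix ρ = |Ψ⁻⟩⟨Ψ⁻| ⊗ |Ψ⁻⟩⟨Ψ⁻| on A, B₁, B₂, C. -/
def ρ₂ : M16 := proj twoSinglets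

/-- Spectral projectors Πˣ_a = ½(I₂ + (−1)^a (σz + (−1)^x σx)/√2) of the
observables (σz ± σx)/√2. -/
def Proj (x a : Fin 2) : M2 :=
  (1 / 2 : ℂ) • ((1 : M2) + (((-1 : ℂ) ^ (a : ℕ)) * invSqrt2) • (σz + ((-1 : ℂ) ^ (x : ℕ)) • σx))

/-- Eigenprojectors Qʸ_s = ½(I₄ + (−1)^s σ⊗σ) of σz⊗σz (y = 0) and σx⊗σx (y = 1);
s = 0 is the "+" projector and s = 1 the "−" projector. -/
def Q (y s : Fin 2) : M4 :=
  (1 / 2 : ℂ) • ((1 : M4) + ((-1 : ℂ) ^ (s : ℕ)) • (if y = 0 then σz ⊗ₖ σz else σx ⊗ₖ σx))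

/-- Correlator ⟨ψ|(A ⊗ C)|ψ⟩ of two single-qubit observables on a two-qubit state. -/
def corr (ψ : Fin 2 × Fin 2 → ℂ) (A C : M2) : ℂ := star ψ ⬝ᵥ ((A ⊗ₖ C) *ᵥ ψ)
theorem invSqrt2_sq_aux : invSqrt2 ^ 2 = 1 / 2 := by
  unfold invSqrt2
  rw [inv_pow, ← Complex.ofReal_pow, Real.sq_sqrt (by norm_num)]
  norm_num

theorem star_invSqrt2_aux : (starRingEnd ℂ) invSqrt2 = invSqrt2 := by
  unfold invSqrt2
  rw [map_inv₀, Complex.conj_ofReal]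

theorem trace_val_aux (a c s : Fin 2) :
    trace (ρ₂ * kron3 (Proj 0 a) (Q 0 s) (Proj 0 c)) =
      1 / 8 + (-1 : ℂ) ^ (a : ℕ) * (-1 : ℂ) ^ (c : ℕ) * (-1 : ℂ) ^ (s : ℕ) / 16 := by
  have h2 := invSqrt2_sq_aux
  have h4 : invSqrt2 ^ 4 = 1 / 4 := by
    rw [show invSqrt2 ^ 4 = (invSqrt2 ^ 2) ^ 2 by ring, h2]; norm_num
  have h6 : invSqrt2 ^ 6 = 1 / 8 := by
    rw [show invSqrt2 ^ 6 = (invSqrt2 ^ 2) ^ 3 by ring, h2]; norm_num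
  have h5 : invSqrt2 ^ 5 = invSqrt2 / 4 := by
    rw [show invSqrt2 ^ 5 = (invSqrt2 ^ 2) ^ 2 * invSqrt2 by ring, h2]; ring
  simp only [Matrix.trace, Matrix.diag, Matrix.mul_apply, Fintype.sum_prod_type, Fin.sum_univ_two,
    ρ₂, proj, twoSinglets, kron3, vecMulVec_apply]
  simp [twoSinglets, PsiM, Proj, Q, σz, σx, star_invSqrt2_aux, Matrix.one_apply]
  generalize (-1 : ℂ) ^ (a : ℕ) = A
  generalize (-1 : ℂ) ^ (c : ℕ) = C
  generalize (-1 : ℂ) ^ (s : ℕ) = S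
  ring_nf
  simp only [h4, h5, h6]
  ring

/-- Informed-guess value for all three outcomes when Bob measures σz⊗σz:
max_{a,c,s} Tr[ρ·(Π⁰_a ⊗ Q⁰_s ⊗ Π⁰_c)] = 3/16 (s = 0 is the "+" outcome,
s = 1 the "−" outcome). -/
theorem informed_guess_ABC_separable :
    (⨆ a : Fin 2, ⨆ c : Fin 2, ⨆ s : Fin 2,
      (trace (ρ₂ * kron3 (Proj 0 a) (Q 0 s) (Proj 0 c))).re) = 3 / 16 := by
  simp only [trace_val_aux]
  have hm : ∀ f : Fin 2 → ℝ, (⨆ i, f i) = max (f 0) (f 1) := by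
    intro f
    apply le_antisymm
    · apply ciSup_le
      intro i
      fin_cases i
      · exact le_max_left _ _
      · exact le_max_right _ _
    · exact max_le (le_ciSup (Set.finite_range f).bddAbove 0)
        (le_ciSup (Set.finite_range f).bddAbove 1)
  simp only [hm]
  norm_num
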